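/- Let S be a finite semigroup with a zero element 0 such that R(S) = {0}, and let M be a non-empty set of minimal idempotents of S satisfying conditions (I)-(III). Let M = M₁ ∪ … ∪ M_k be the partition of M into equivalence classes of the D-relation (e, f ∈ M are equivalent iff (e) = (f)), and let n = max_i |M_i|. Then the number of maximal nilpotent subsemigroups of S equals |M₁|!·|M₂|!·…·|M_k|!, the nilpotency class of every nilpotent subsemigroup of S is at most n, and the nilpotency class of every maximal nilpotent subsemigroup of S equals n. -/

import Mathlib

/-! Basic notions for nilpotent subsemigroups of a semigroup with zero,
following Ganyushkin–Mazorchuk, "On classification of maximal nilpotent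
subsemigroups". -/

/-- The product `a * l₀ * l₁ * ⋯` of a nonempty list of semigroup elements
(the element `a` followed by the elements of the list `l`). -/
def prodl {S : Type*} [Mul S] (a : S) (l : List S) : S := l.foldl (· * ·) a

/-- `T` is a subsemigroup of `S`, i.e. closed under multiplication. -/
def IsSubsgp {S : Type*} [Mul S] (T : Set S) : Prop :=
  ∀ ⦃a b : S⦄, a ∈ T → b ∈ T → a * b ∈ T

/-- Every product of `k` elements of `T` equals `0`. -/
def ProdZero {S : Type*} [Mul S] [Zero S] (T : Set S) (k : ℕ) : Prop :=
  ∀ (a : S) (l : List S), a ∈ T → (∀ x ∈ l, x ∈ T) → l.length + 1 = k →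
    prodl a l = 0

/-- `T` is a nilpotent subsemigroup: it is closed under multiplication and some
positive power of it vanishes. -/
def IsNilpSubsgp {S : Type*} [Mul S] [Zero S] (T : Set S) : Prop :=
  IsSubsgp T ∧ ∃ k : ℕ, 1 ≤ k ∧ ProdZero T k

/-- `k` is the nilpotency class of `T`: the least positive integer such that
every product of `k` elements of `T` equals `0`. -/
def NilpClass {S : Type*} [Mul S] [Zero S] (T : Set S) (k : ℕ) : Prop :=
  1 ≤ k ∧ ProdZero T k ∧ ∀ m : ℕ, 1 ≤ m → ProdZero T m → k ≤ m

/-- `T` is a maximal nilpotent subsemigroup of `S`: a maximal element of the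
set of nilpotent subsemigroups of `S` ordered by inclusion. -/
def IsMaxNilpSubsgp {S : Type*} [Mul S] [Zero S] (T : Set S) : Prop :=
  IsNilpSubsgp T ∧ ∀ T' : Set S, IsNilpSubsgp T' → T ⊆ T' → T' = T

/-- The principal left ideal `S¹a = {a} ∪ Sa`. -/
def lId {S : Type*} [Mul S] (a : S) : Set S := insert a {x | ∃ u, x = u * a}

/-- The principal right ideal `aS¹ = {a} ∪ aS`. -/
def rId {S : Type*} [Mul S] (a : S) : Set S := insert a {x | ∃ v, x = a * v}

/-- The principal two-sided ideal `(a) = S¹aS¹ = {a} ∪ Sa ∪ aS ∪ SaS`. -/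
def pId {S : Type*} [Mul S] (a : S) : Set S :=
  insert a ({x | ∃ u, x = u * a} ∪ {x | ∃ v, x = a * v} ∪ {x | ∃ u v, x = u * a * v})

/-- The radical `R(S)`: the set of `x ∈ S` such that the subsemigroup
`(x) = S¹xS¹` is nilpotent. -/
def radical (S : Type*) [Mul S] [Zero S] : Set S :=
  {x | ∃ k : ℕ, 1 ≤ k ∧ ProdZero (pId x) k}

/-- The J(=D for finite semigroups)-class of `a` is a minimal nonzero class:
`a ≠ 0` and every principal ideal contained in `(a)` is either `{0}` or equals
`(a)`. -/
def InMinClass {S : Type*} [Mul S] [Zero S] (a : S) : Prop :=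
  a ≠ 0 ∧ ∀ b : S, pId b ⊆ pId a → b = 0 ∨ pId b = pId a

/-- A minimal idempotent: a nonzero idempotent lying in a minimal D-class. -/
def MinIdem {S : Type*} [Mul S] [Zero S] (e : S) : Prop :=
  e * e = e ∧ InMinClass e

/-- Condition (I): the elements of `M` commute pairwise. -/
def CondI {S : Type*} [Mul S] (M : Set S) : Prop :=
  ∀ e ∈ M, ∀ f ∈ M, e * f = f * e

/-- Condition (II): for every nonzero `x ∈ S` there are `e, f ∈ M` with
`e * x * f ≠ 0`. -/
def CondII {S : Type*} [Mul S] [Zero S] (M : Set S) : Prop :=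
  ∀ x : S, x ≠ 0 → ∃ e ∈ M, ∃ f ∈ M, e * x * f ≠ 0

/-- Condition (III): for all `x, y ∈ S` and `e, f ∈ M` one has
`{exgyf : g ∈ M} ⊆ {0, exyf}`, and if `exyf ≠ 0` then `exgyf ≠ 0` for some
`g ∈ M`. -/
def CondIII {S : Type*} [Mul S] [Zero S] (M : Set S) : Prop :=
  ∀ x y : S, ∀ e ∈ M, ∀ f ∈ M,
    (∀ g ∈ M, e * x * g * y * f = 0 ∨ e * x * g * y * f = e * x * y * f) ∧
    (e * x * y * f ≠ 0 → ∃ g ∈ M, e * x * g * y * f ≠ 0)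

/-- `ρ` is a strict partial order on the set `M`. -/
def IsStrictOrderOn {S : Type*} (M : Set S) (ρ : S → S → Prop) : Prop :=
  (∀ e ∈ M, ¬ ρ e e) ∧
  (∀ e ∈ M, ∀ f ∈ M, ∀ g ∈ M, ρ e f → ρ f g → ρ e g)

/-- `Mon M ρ = {x ∈ S : for all e, f ∈ M, e * x * f ≠ 0 implies ρ e f}`. -/
def Mon {S : Type*} [Mul S] [Zero S] (M : Set S) (ρ : S → S → Prop) : Set S :=
  {x : S | ∀ e ∈ M, ∀ f ∈ M, e * x * f ≠ 0 → ρ e f}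

/-- The relation `ρ_T` associated to a subset `T ⊆ S`:
`ρ_T e f ↔ e * x * f ≠ 0 for some x ∈ T`. -/
def rhoRel {S : Type*} [Mul S] [Zero S] (T : Set S) (e f : S) : Prop :=
  ∃ x ∈ T, e * x * f ≠ 0

section PrincipalIdeals

variable {S : Type*} [SemigroupWithZero S]

theorem mem_pId_self (a : S) : a ∈ pId a := Or.inl rfl

theorem mul_mem_pId (a v : S) : a * v ∈ pId a := Or.inr (Or.inl (Or.inr ⟨v, rfl⟩))

theorem mul_mem_pId' (u a : S) : u * a ∈ pId a := Or.inr (Or.inl (Or.inl ⟨u, rfl⟩))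

theorem mul_left_mem_pId {a b : S} (u : S) (h : b ∈ pId a) : u * b ∈ pId a := by
  rcases h with rfl | (⟨p, rfl⟩ | ⟨q, rfl⟩) | ⟨p, q, rfl⟩
  · exact mul_mem_pId' _ _
  · exact Or.inr (Or.inl (Or.inl ⟨u * p, (mul_assoc _ _ _).symm⟩))
  · exact Or.inr (Or.inr ⟨u, q, (mul_assoc _ _ _).symm⟩)
  · exact Or.inr (Or.inr ⟨u * p, q, by simp only [mul_assoc]⟩)

theorem mul_right_mem_pId {a b : S} (v : S) (h : b ∈ pId a) : b * v ∈ pId a := by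
  rcases h with rfl | (⟨p, rfl⟩ | ⟨q, rfl⟩) | ⟨p, q, rfl⟩
  · exact mul_mem_pId _ _
  · exact Or.inr (Or.inr ⟨p, v, rfl⟩)
  · exact Or.inr (Or.inl (Or.inr ⟨q * v, mul_assoc _ _ _⟩))
  · exact Or.inr (Or.inr ⟨p, q * v, mul_assoc _ _ _⟩)

theorem pId_subset_of_mem {a b : S} (h : b ∈ pId a) : pId b ⊆ pId a := by
  rintro c (rfl | (⟨u, rfl⟩ | ⟨v, rfl⟩) | ⟨u, v, rfl⟩)
  · exact h
  · exact mul_left_mem_pId u h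
  · exact mul_right_mem_pId v h
  · exact mul_right_mem_pId v (mul_left_mem_pId u h)

theorem exists_eq_mul_mul_of_mem_pId {e a : S} (he : e * e = e) (h : e ∈ pId a) :
    ∃ u v, u * a * v = e := by
  rcases h with rfl | (⟨u, hu⟩ | ⟨v, hv⟩) | ⟨u, v, h⟩
  · exact ⟨e, e, by rw [he, he]⟩
  · exact ⟨u, e, by rw [← hu, he]⟩
  · exact ⟨e, v, by rw [mul_assoc, ← hv, he]⟩
  · exact ⟨u, v, h.symm⟩

theorem MinIdem.pId_eq {e a : S} (he : MinIdem e) (ha : a ≠ 0) (h : a ∈ pId e) :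
    pId a = pId e :=
  (he.2.2 a (pId_subset_of_mem h)).resolve_left ha

theorem MinIdem.pId_eq_of_mul_mul_ne_zero {e f x : S} (he : MinIdem e) (hf : MinIdem f)
    (h : e * x * f ≠ 0) : pId e = pId f := by
  rw [← hf.pId_eq h (mul_mem_pId' _ _)]
  refine (he.pId_eq h ?_).symm
  rw [mul_assoc]
  exact mul_mem_pId _ _

/-- Finite local monoids `eSe` are Dedekind-finite. -/
theorem mul_eq_idem_comm [Finite S] {e a b : S} (hee : e * e = e) (hae : a * e = a) (heb : e * b = b)
    (hab : a * b = e) : b * a = e := by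
  let φ : {x : S // e * x = x} → {x : S // e * x = x} :=
    fun x ↦ ⟨b * x.1, by rw [← mul_assoc, heb]⟩
  have hinv : ∀ x : {x : S // e * x = x}, a * (φ x).1 = x.1 := fun x ↦ by
    change a * (b * x.1) = x.1
    rw [← mul_assoc, hab, x.2]
  have hφ : Function.Injective φ := fun x y hxy ↦ Subtype.ext (by rw [← hinv x, hxy, hinv y])
  obtain ⟨x, hx⟩ := Finite.surjective_of_injective hφ ⟨e, hee⟩
  have hax := hinv x
  rw [hx] at hax
  have hbx : b * x.1 = e := congrArg Subtype.val hx
  rw [← hae, hax, hbx]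

theorem MinIdem.exists_left_inv [Finite S] {f a : S} (hf : MinIdem f) (ha : a ≠ 0)
    (haf : a * f = a) : ∃ b, b * a = f := by
  have hmem : f ∈ pId a := by
    have h : a ∈ pId f := by
      rw [← haf]
      exact mul_mem_pId' _ _
    rw [hf.pId_eq ha h]
    exact mem_pId_self f
  obtain ⟨u, v, huv⟩ := exists_eq_mul_mul_of_mem_pId hf.1 hmem
  refine ⟨f * v * f * (f * u), ?_⟩
  rw [mul_assoc]
  refine mul_eq_idem_comm hf.1 ?_ ?_ ?_
  · rw [mul_assoc, haf]
  · rw [← mul_assoc, ← mul_assoc, hf.1]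
  · calc f * u * a * (f * v * f) = f * (u * (a * f) * v) * f := by simp only [mul_assoc]
      _ = f := by rw [haf, huv, hf.1, hf.1]

theorem MinIdem.mul_ne_zero [Finite S] {f a b : S} (hf : MinIdem f) (ha : a ≠ 0)
    (hb : b ≠ 0) (haf : a * f = a) (hfb : f * b = b) : a * b ≠ 0 := by
  obtain ⟨c, hc⟩ := hf.exists_left_inv ha haf
  intro h
  apply hb
  rw [← hfb, ← hc, mul_assoc, h, mul_zero]

theorem MinIdem.mul_eq_zero [Finite S] {e f : S} (he : MinIdem e) (hf : MinIdem f)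
    (hef : e * f = f * e) (hne : e ≠ f) : e * f = 0 := by
  by_contra h
  apply hne
  obtain ⟨b, hb⟩ := hf.exists_left_inv h (by rw [mul_assoc, hf.1])
  obtain ⟨c, hc⟩ := he.exists_left_inv h (by rw [hef, mul_assoc, he.1])
  have hf' : f * e = f := by
    rw [← hb, mul_assoc, mul_assoc, ← hef, ← mul_assoc e e, he.1]
  have he' : e * f = e := by
    rw [← hc, mul_assoc, mul_assoc, hf.1]
  rw [← he', hef, hf']

end PrincipalIdeals

section Products

variable {S : Type*} [SemigroupWithZero S]

theorem prodl_append_singleton (a : S) (l : List S) (b : S) :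
    prodl a (l ++ [b]) = prodl a l * b := by
  simp [prodl]

theorem ProdZero.subset {T T' : Set S} {k : ℕ} (h : ProdZero T' k) (hT : T ⊆ T') :
    ProdZero T k :=
  fun a l ha hl hlen ↦ h a l (hT ha) (fun x hx ↦ hT (hl x hx)) hlen

end Products

section Orders

variable {S : Type*} [SemigroupWithZero S] {M : Set S}

/-- The order on `M` comparing elements of the same D-class by their `r`-value. -/
def rankRel (r : S → ℕ) (e f : S) : Prop := pId e = pId f ∧ r e < r f

theorem isSubsgp_Mon (h3 : CondIII M) {ρ : S → S → Prop}
    (hρ : ∀ e ∈ M, ∀ f ∈ M, ∀ g ∈ M, ρ e f → ρ f g → ρ e g) : IsSubsgp (Mon M ρ) := by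
  intro x y hx hy e he f hf h
  rw [← mul_assoc] at h
  obtain ⟨g, hg, hxy⟩ := (h3 x y e he f hf).2 h
  refine hρ e he g hg f hf (hx e he g hg fun h0 ↦ hxy ?_) (hy g hg f hf fun h0 ↦ hxy ?_)
  · rw [h0, zero_mul, zero_mul]
  · rw [mul_assoc (e * x), mul_assoc (e * x), h0, mul_zero]

theorem isSubsgp_Mon_rankRel (h3 : CondIII M) (r : S → ℕ) : IsSubsgp (Mon M (rankRel r)) :=
  isSubsgp_Mon h3 fun _ _ _ _ _ _ h h' ↦ ⟨h.1.trans h'.1, h.2.trans h'.2⟩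

theorem rank_add_length_lt (h3 : CondIII M) {r : S → ℕ} {a : S} {l : List S}
    (ha : a ∈ Mon M (rankRel r)) (hl : ∀ x ∈ l, x ∈ Mon M (rankRel r)) {e f : S} (he : e ∈ M)
    (hf : f ∈ M) (h : e * prodl a l * f ≠ 0) : r e + l.length < r f := by
  induction l using List.reverseRecOn generalizing f with
  | nil => exact (ha e he f hf h).2
  | append_singleton l b ih =>
    rw [prodl_append_singleton, ← mul_assoc] at h
    obtain ⟨g, hg, hg'⟩ := (h3 _ b e he f hf).2 h
    have h₁ := ih (fun x hx ↦ hl x (by simp [hx])) hg fun h0 ↦ hg' (by rw [h0, zero_mul, zero_mul])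
    have h₂ := (hl b (by simp) g hg f hf fun h0 ↦ hg' (by
      rw [mul_assoc (_ * _) g, mul_assoc (_ * _), h0, mul_zero])).2
    simp only [List.length_append, List.length_singleton]
    omega

theorem prodZero_Mon_rankRel (h2 : CondII M) (h3 : CondIII M) {r : S → ℕ} {n : ℕ}
    (hr : ∀ e ∈ M, r e < n) : ProdZero (Mon M (rankRel r)) n := by
  intro a l ha hl hlen
  by_contra h
  obtain ⟨e, he, f, hf, hef⟩ := h2 _ h
  have h₁ := rank_add_length_lt h3 ha hl he hf hef
  have h₂ := hr f hf
  omega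

variable [Finite S]

theorem mul_mul_ne_zero_trans (hMmin : ∀ e ∈ M, MinIdem e) (h3 : CondIII M) {e f g x y : S}
    (he : e ∈ M) (hf : f ∈ M) (hg : g ∈ M) (hx : e * x * f ≠ 0) (hy : f * y * g ≠ 0) :
    e * (x * y) * g ≠ 0 := by
  have hff := (hMmin f hf).1
  have h := (hMmin f hf).mul_ne_zero hx hy (by rw [mul_assoc, hff])
    (by rw [← mul_assoc, ← mul_assoc, hff])
  have heq : e * x * f * (f * y * g) = e * x * f * y * g := by
    rw [← mul_assoc, ← mul_assoc, mul_assoc (e * x) f f, hff]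
  rw [heq] at h
  rw [← mul_assoc]
  rw [((h3 x y e he g hg).1 f hf).resolve_left h] at h
  exact h

theorem mul_mul_self_eq_zero (hMmin : ∀ e ∈ M, MinIdem e) (h3 : CondIII M) {T : Set S}
    (hT : IsNilpSubsgp T) {e x : S} (he : e ∈ M) (hx : x ∈ T) : e * x * e = 0 := by
  by_contra h
  obtain ⟨-, k, hk, hTk⟩ := hT
  have key : ∀ n : ℕ, e * prodl x (List.replicate n x) * e ≠ 0 := by
    intro n
    induction n with
    | zero => exact h
    | succ n ih =>
      rw [List.replicate_succ', prodl_append_singleton]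
      exact mul_mul_ne_zero_trans hMmin h3 he he he ih h
  apply key (k - 1)
  rw [hTk x _ hx (fun y hy ↦ List.eq_of_mem_replicate hy ▸ hx) (by simp; omega), mul_zero, zero_mul]

theorem exists_mem_Mon_rankRel (hMmin : ∀ e ∈ M, MinIdem e) (h1 : CondI M) {r : S → ℕ}
    {e f : S} (he : e ∈ M) (hf : f ∈ M) (h : rankRel r e f) :
    ∃ x ∈ Mon M (rankRel r), e * x * f ≠ 0 := by
  have hee := (hMmin e he).1
  have hff := (hMmin f hf).1
  obtain ⟨u, v, huv⟩ := exists_eq_mul_mul_of_mem_pId hee (h.1 ▸ mem_pId_self e)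
  have hne : e * u * f ≠ 0 := by
    intro h0
    apply (hMmin e he).2.1
    calc e = e * (u * f * v) := by rw [huv, hee]
      _ = e * u * f * v := by simp only [mul_assoc]
      _ = 0 := by rw [h0, zero_mul]
  refine ⟨e * u * f, fun e' he' f' hf' hx ↦ ?_, ?_⟩
  · have hee' : e' = e := by
      by_contra hc
      apply hx
      rw [← mul_assoc, ← mul_assoc, (hMmin e' he').mul_eq_zero (hMmin e he) (h1 _ he' _ he) hc]
      simp only [zero_mul]
    have hff' : f' = f := by
      by_contra hc
      apply hx
      rw [mul_assoc, mul_assoc _ f,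
        (hMmin f hf).mul_eq_zero (hMmin f' hf') (h1 _ hf _ hf') (Ne.symm hc)]
      simp only [mul_zero]
    rwa [hee', hff']
  · rwa [← mul_assoc, ← mul_assoc, hee, mul_assoc, hff]

theorem isMaxNilpSubsgp_Mon_rankRel (hMne : M.Nonempty) (hMmin : ∀ e ∈ M, MinIdem e)
    (h1 : CondI M) (h2 : CondII M) (h3 : CondIII M) {r : S → ℕ} {n : ℕ} (hr : ∀ e ∈ M, r e < n)
    (hinj : ∀ e ∈ M, ∀ f ∈ M, pId e = pId f → r e = r f → e = f) :
    IsMaxNilpSubsgp (Mon M (rankRel r)) := by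
  have hn : 1 ≤ n := by
    obtain ⟨e, he⟩ := hMne
    have := hr e he
    omega
  refine ⟨⟨isSubsgp_Mon_rankRel h3 r, n, hn, prodZero_Mon_rankRel h2 h3 hr⟩,
    fun T hT hle ↦ Set.Subset.antisymm (fun x hx e he f hf h ↦ ?_) hle⟩
  have hef := (hMmin e he).pId_eq_of_mul_mul_ne_zero (hMmin f hf) h
  refine ⟨hef, ?_⟩
  by_contra hlt
  rcases (not_lt.mp hlt).eq_or_lt with heq | hlt
  · obtain rfl := hinj e he f hf hef heq.symm
    exact h (mul_mul_self_eq_zero hMmin h3 hT he hx)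
  · obtain ⟨y, hy, hfy⟩ := exists_mem_Mon_rankRel hMmin h1 hf he (r := r) ⟨hef.symm, hlt⟩
    exact mul_mul_ne_zero_trans hMmin h3 he hf he h hfy
      (mul_mul_self_eq_zero hMmin h3 hT he (hT.1 hx (hle hy)))

theorem exists_prodl_ne_zero (hMmin : ∀ e ∈ M, MinIdem e) (h1 : CondI M) (h3 : CondIII M)
    {r : S → ℕ} (c : ℕ → S) {n : ℕ} (hc : ∀ i < n, c i ∈ M)
    (hrc : ∀ i, i + 1 < n → rankRel r (c i) (c (i + 1))) (m : ℕ) (hm : m + 1 < n) :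
    ∃ a ∈ Mon M (rankRel r), ∃ l : List S, (∀ x ∈ l, x ∈ Mon M (rankRel r)) ∧ l.length = m ∧
      c 0 * prodl a l * c (m + 1) ≠ 0 := by
  induction m with
  | zero =>
    obtain ⟨a, ha, h⟩ := exists_mem_Mon_rankRel hMmin h1 (hc 0 (by omega)) (hc 1 hm) (hrc 0 hm)
    exact ⟨a, ha, [], by simp, rfl, h⟩
  | succ m ih =>
    obtain ⟨a, ha, l, hl, hlen, h⟩ := ih (by omega)
    obtain ⟨b, hb, h'⟩ := exists_mem_Mon_rankRel hMmin h1 (hc (m + 1) (by omega)) (hc _ hm)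
      (hrc _ hm)
    refine ⟨a, ha, l ++ [b], ?_, by simp [hlen], ?_⟩
    · intro x hx
      rcases List.mem_append.mp hx with hx | hx
      · exact hl x hx
      · rwa [List.mem_singleton.mp hx]
    · rw [prodl_append_singleton]
      exact mul_mul_ne_zero_trans hMmin h3 (hc 0 (by omega)) (hc _ (by omega)) (hc _ hm) h h'

end Orders

section Enumerations

/-- A strict order on a finite type extends to an enumeration of the type. -/
theorem exists_equiv_fin_of_isStrictOrder {α : Type*} [Finite α] (ρ : α → α → Prop)
    (hirr : ∀ a, ¬ ρ a a) (htrans : ∀ a b c, ρ a b → ρ b c → ρ a c) {n : ℕ}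
    (hn : Nat.card α = n) : ∃ σ : α ≃ Fin n, ∀ a b, ρ a b → σ a < σ b := by
  classical
  let : IsStrictOrder α ρ := { irrefl := hirr, trans := htrans }
  let : PartialOrder α := partialOrderOfSO ρ
  let : Fintype (LinearExtension α) := @Fintype.ofFinite α _
  have hcard : Fintype.card (LinearExtension α) = n := by
    rw [← Nat.card_eq_fintype_card]
    exact hn
  let φ := Fintype.orderIsoFinOfCardEq (LinearExtension α) hcard
  refine ⟨φ.symm.toEquiv, fun a b hab ↦ ?_⟩
  refine φ.symm.lt_iff_lt.mpr (lt_of_le_of_ne (toLinearExtension.monotone (Or.inr hab)) ?_)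
  rintro (rfl : a = b)
  exact hirr _ hab

theorem equiv_fin_ext {α : Type*} {n : ℕ} {σ τ : α ≃ Fin n}
    (h : ∀ a b, σ a < σ b ↔ τ a < τ b) : σ = τ := by
  let φ : Fin n ≃o Fin n :=
    { toEquiv := σ.symm.trans τ
      map_rel_iff' := by
        intro i j
        have := h (σ.symm j) (σ.symm i)
        simp only [Equiv.apply_symm_apply] at this
        simp only [Equiv.trans_apply]
        rw [← not_lt, ← not_lt, this] }
  have hφ : φ = OrderIso.refl _ := Subsingleton.elim _ _
  ext a
  have := congrArg (fun ψ : Fin n ≃o Fin n ↦ ((ψ (σ a) : Fin n) : ℕ)) hφ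
  simpa [φ] using this.symm

/-- A choice of enumeration of every D-class of `M`. -/
abbrev ClassEnum {S : Type*} [Mul S] (M : Set S) : Type _ :=
  ∀ I : Set S, ({f ∈ M | pId f = I} : Set S) ≃ Fin ({f ∈ M | pId f = I} : Set S).ncard

open Classical in
/-- The position of an element of `M` in the enumeration of its D-class. -/
noncomputable def classRank {S : Type*} [Mul S] {M : Set S} (σ : ClassEnum M) (e : S) : ℕ :=
  if h : e ∈ M then σ (pId e) ⟨e, h, rfl⟩ else 0

theorem classRank_coe {S : Type*} [Mul S] {M : Set S} (σ : ClassEnum M) (I : Set S)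
    (e : ({f ∈ M | pId f = I} : Set S)) : classRank σ (e : S) = σ I e := by
  obtain ⟨e, he, rfl⟩ := e
  simp [classRank, he]

theorem classRank_lt {S : Type*} [Mul S] {M : Set S} (σ : ClassEnum M) {e : S} (he : e ∈ M) :
    classRank σ e < ({f ∈ M | pId f = pId e} : Set S).ncard := by
  rw [classRank_coe σ (pId e) ⟨e, he, rfl⟩]
  exact Fin.is_lt _

theorem classRank_inj {S : Type*} [Mul S] {M : Set S} (σ : ClassEnum M) {e f : S} (he : e ∈ M)
    (hf : f ∈ M) (hef : pId e = pId f) (h : classRank σ e = classRank σ f) : e = f := by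
  rw [classRank_coe σ (pId f) ⟨e, he, hef⟩, classRank_coe σ (pId f) ⟨f, hf, rfl⟩] at h
  exact congrArg Subtype.val ((σ _).injective (Fin.ext h))

variable {S : Type*} [SemigroupWithZero S] [Finite S] {M : Set S}

theorem IsNilpSubsgp.exists_subset_Mon (hMmin : ∀ e ∈ M, MinIdem e) (h3 : CondIII M)
    {T : Set S} (hT : IsNilpSubsgp T) :
    ∃ σ : ClassEnum M, T ⊆ Mon M (rankRel (classRank σ)) := by
  have key : ∀ I : Set S, ∃ τ : ({f ∈ M | pId f = I} : Set S) ≃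
      Fin ({f ∈ M | pId f = I} : Set S).ncard,
      ∀ a b : ({f ∈ M | pId f = I} : Set S), rhoRel T (a : S) (b : S) → τ a < τ b := by
    intro I
    refine exists_equiv_fin_of_isStrictOrder
      (fun a b : ({f ∈ M | pId f = I} : Set S) ↦ rhoRel T (a : S) (b : S)) ?_ ?_ (Nat.card_coe_set_eq _)
    · rintro a ⟨x, hx, h⟩
      exact h (mul_mul_self_eq_zero hMmin h3 hT a.2.1 hx)
    · rintro a b c ⟨x, hx, h⟩ ⟨y, hy, h'⟩
      exact ⟨x * y, hT.1 hx hy, mul_mul_ne_zero_trans hMmin h3 a.2.1 b.2.1 c.2.1 h h'⟩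
  choose σ hσ using key
  refine ⟨σ, fun x hx e he f hf h ↦ ?_⟩
  have hef := (hMmin e he).pId_eq_of_mul_mul_ne_zero (hMmin f hf) h
  refine ⟨hef, ?_⟩
  rw [classRank_coe σ (pId f) ⟨e, he, hef⟩, classRank_coe σ (pId f) ⟨f, hf, rfl⟩]
  exact hσ _ _ _ ⟨x, hx, h⟩

theorem Mon_classRank_injective (hMmin : ∀ e ∈ M, MinIdem e) (h1 : CondI M) :
    Function.Injective fun σ : ClassEnum M ↦ Mon M (rankRel (classRank σ)) := by
  have key : ∀ σ τ : ClassEnum M,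
      Mon M (rankRel (classRank σ)) = Mon M (rankRel (classRank τ)) →
      ∀ I a b, σ I a < σ I b → τ I a < τ I b := by
    intro σ τ h I a b hab
    rw [Fin.lt_def, ← classRank_coe, ← classRank_coe] at hab
    obtain ⟨x, hx, hne⟩ := exists_mem_Mon_rankRel hMmin h1 a.2.1 b.2.1
      ⟨a.2.2.trans b.2.2.symm, hab⟩
    rw [h] at hx
    have := (hx _ a.2.1 _ b.2.1 hne).2
    rwa [classRank_coe, classRank_coe] at this
  intro σ τ h
  funext I
  exact equiv_fin_ext fun a b ↦ ⟨key σ τ h I a b, key τ σ h.symm I a b⟩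

theorem card_classEnum (M : Set S) :
    Nat.card (ClassEnum M) = ∏ I ∈ (Set.toFinite (pId '' M)).toFinset,
      Nat.factorial ({f ∈ M | pId f = I} : Set S).ncard := by
  classical
  let : Fintype (Set S) := Fintype.ofFinite _
  have hcard : ∀ I : Set S, Nat.card (({f ∈ M | pId f = I} : Set S) ≃
      Fin ({f ∈ M | pId f = I} : Set S).ncard) =
      Nat.factorial ({f ∈ M | pId f = I} : Set S).ncard := by
    intro I
    let : Fintype ({f ∈ M | pId f = I} : Set S) := Fintype.ofFinite _
    rw [Nat.card_eq_fintype_card,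
      Fintype.card_equiv (Finite.equivFinOfCardEq (Nat.card_coe_set_eq _)),
      ← Nat.card_eq_fintype_card, Nat.card_coe_set_eq]
  rw [Nat.card_pi, Finset.prod_congr rfl fun I _ ↦ hcard I]
  refine (Finset.prod_subset (Finset.subset_univ _) fun I _ hI ↦ ?_).symm
  have hempty : ({f ∈ M | pId f = I} : Set S) = ∅ := by
    ext f
    simp only [Set.mem_ofPred_eq, Set.mem_empty_iff_false, iff_false]
    rintro ⟨hf, rfl⟩
    exact hI (by simpa using ⟨f, hf, rfl⟩)
  rw [hempty, Set.ncard_empty, Nat.factorial_zero]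

end Enumerations

/-- Let `S` be a finite semigroup with zero with
`R(S) = {0}` and `M` a nonempty set of minimal idempotents satisfying
(I)–(III). Let `M = M₁ ∪ ⋯ ∪ M_k` be the partition of `M` into D-classes
(`e ~ f` iff `(e) = (f)`) and let `n = max_i |M_i|`. Then the number of
maximal nilpotent subsemigroups of `S` equals `∏ i, |M_i|!` (the product over
the D-classes, indexed by the principal ideals of elements of `M`), the
nilpotency class of every nilpotent subsemigroup of `S` is at most `n`, and
the nilpotency class of every maximal nilpotent subsemigroup equals `n`. -/
theorem statement18 {S : Type*} [SemigroupWithZero S] [Finite S]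
    (hrad : radical S = {0}) (M : Set S) (hMne : M.Nonempty)
    (hMmin : ∀ e ∈ M, MinIdem e)
    (h1 : CondI M) (h2 : CondII M) (h3 : CondIII M)
    (n : ℕ)
    (hn1 : ∀ e ∈ M, ({f ∈ M | pId f = pId e} : Set S).ncard ≤ n)
    (hn2 : ∃ e ∈ M, ({f ∈ M | pId f = pId e} : Set S).ncard = n) :
    Set.ncard {T : Set S | IsMaxNilpSubsgp T} =
      (∏ I ∈ (Set.toFinite (pId '' M)).toFinset,
        Nat.factorial ({f ∈ M | pId f = I} : Set S).ncard) ∧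
    (∀ T : Set S, IsNilpSubsgp T → ∀ c : ℕ, NilpClass T c → c ≤ n) ∧
    (∀ T : Set S, IsMaxNilpSubsgp T → NilpClass T n) := by
  have hlt : ∀ σ : ClassEnum M, ∀ e ∈ M, classRank σ e < n := fun σ e he ↦
    (classRank_lt σ he).trans_le (hn1 e he)
  have hpos : 1 ≤ n := by
    obtain ⟨e, he, rfl⟩ := hn2
    exact (Set.ncard_pos (Set.toFinite _)).mpr ⟨e, he, rfl⟩
  have hmax : ∀ σ : ClassEnum M, IsMaxNilpSubsgp (Mon M (rankRel (classRank σ))) := fun σ ↦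
    isMaxNilpSubsgp_Mon_rankRel hMne hMmin h1 h2 h3 (hlt σ) fun _ he _ hf ↦
      classRank_inj σ he hf
  have hsurj : ∀ T : Set S, IsMaxNilpSubsgp T →
      ∃ σ : ClassEnum M, Mon M (rankRel (classRank σ)) = T := fun T hT ↦ by
    obtain ⟨σ, hσ⟩ := hT.1.exists_subset_Mon hMmin h3
    exact ⟨σ, hT.2 _ (hmax σ).1 hσ⟩
  refine ⟨?_, ?_, ?_⟩
  · rw [← card_classEnum, ← Nat.card_range_of_injective (Mon_classRank_injective hMmin h1),
      Nat.card_coe_set_eq]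
    congr 1
    ext T
    exact ⟨hsurj T, fun ⟨σ, hσ⟩ ↦ hσ ▸ hmax σ⟩
  · intro T hT c hc
    obtain ⟨σ, hσ⟩ := hT.exists_subset_Mon hMmin h3
    exact hc.2.2 n hpos ((prodZero_Mon_rankRel h2 h3 (hlt σ)).subset hσ)
  · intro T hT
    obtain ⟨σ, rfl⟩ := hsurj T hT
    refine ⟨hpos, prodZero_Mon_rankRel h2 h3 (hlt σ), fun m hm hzero ↦ ?_⟩
    by_contra hmn
    obtain ⟨e, he, hen⟩ := hn2
    let d : Fin n → ({f ∈ M | pId f = pId e} : Set S) := fun i ↦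
      (σ (pId e)).symm (Fin.cast hen.symm i)
    have hd : ∀ i, classRank σ (d i : S) = i := fun i ↦ by
      simp [classRank_coe, d]
    let c : ℕ → S := fun i ↦ if h : i < n then d ⟨i, h⟩ else e
    have hc : ∀ i (h : i < n), c i = d ⟨i, h⟩ := fun i h ↦ dif_pos h
    obtain ⟨a, ha, l, hl, hlen, hne⟩ := exists_prodl_ne_zero hMmin h1 h3 (r := classRank σ) c
      (fun i hi ↦ hc i hi ▸ (d _).2.1)
      (fun i hi ↦ by
        rw [hc i (by omega), hc _ hi]
        refine ⟨(d _).2.2.trans (d _).2.2.symm, ?_⟩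
        rw [hd, hd]
        exact Nat.lt_succ_self i) (m - 1) (by omega)
    apply hne
    rw [hzero a l ha hl (by omega), mul_zero, zero_mul]
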